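/- arXiv:2401.01225 — 2 statements merged into one kernel-verified Lean document; each statement's English description precedes it below -/
import Mathlib

section
/- In the ring of formal power series in two variables x, y over ℤ, the bivariate generating function F^P(x,y) = Σ_{n≥0} Σ_{0≤k≤n} J^P_{k,n} x^k y^n satisfies the identity (1 − x y² − x² y³) · F^P(x,y) = 1 + x y − x y² + x² y² − x² y³. -/
open Filter

/-- A configuration of length `n`: lots are indexed `1,…,n`; houses may only stand there. -/
def InRange (n : ℕ) (c : ℕ → Bool) : Prop := ∀ i, c i = true → 1 ≤ i ∧ i ≤ n

/-- Lot `i` receives sunlight: it is a boundary lot, or one of its neighbours is empty. -/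
def Sun (n : ℕ) (c : ℕ → Bool) (i : ℕ) : Prop :=
  i = 1 ∨ i = n ∨ c (i - 1) = false ∨ c (i + 1) = false

/-- Every occupied lot receives sunlight. -/
def Permissible (n : ℕ) (c : ℕ → Bool) : Prop := ∀ i, c i = true → Sun n c i

/-- The configuration obtained by occupying lot `j`. -/
def occupy (c : ℕ → Bool) (j : ℕ) : ℕ → Bool := fun i => if i = j then true else c i

/-- Maximal (jammed): permissible, and occupying any empty lot breaks permissibility. -/
def IsMaximal (n : ℕ) (c : ℕ → Bool) : Prop :=
  Permissible n c ∧ ∀ j, 1 ≤ j → j ≤ n → c j = false → ¬ Permissible n (occupy c j)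

/-- Resistant to predators: a house built on any empty lot would get no sunlight. -/
def ResistPred (n : ℕ) (c : ℕ → Bool) : Prop :=
  ∀ j, 1 ≤ j → j ≤ n → c j = false → ¬ Sun n (occupy c j) j

/-- Resistant to altruists: a house built on any empty lot would cut off sunlight
from some other occupied lot. -/
def ResistAlt (n : ℕ) (c : ℕ → Bool) : Prop :=
  ∀ j, 1 ≤ j → j ≤ n → c j = false →
    ∃ i, i ≠ j ∧ c i = true ∧ ¬ Sun n (occupy c j) i

/-- Number of occupied lots. -/
def occ (n : ℕ) (c : ℕ → Bool) : ℕ :=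
  ((Finset.Icc 1 n).filter (fun i => c i = true)).card

/-- `JP k n`: number of maximal configurations of length `n` with `k` occupied lots
that are resistant to predators. -/
noncomputable def JP (k n : ℕ) : ℕ :=
  Nat.card {c : ℕ → Bool //
    InRange n c ∧ IsMaximal n c ∧ ResistPred n c ∧ occ n c = k}

noncomputable def Xx : MvPowerSeries (Fin 2) ℤ := MvPowerSeries.X 0
noncomputable def Yy : MvPowerSeries (Fin 2) ℤ := MvPowerSeries.X 1

/-- The bivariate generating function of `JP`: coefficient of `x^k y^n` is `J^P_{k,n}`
(for `0 ≤ k ≤ n`). -/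
noncomputable def FP : MvPowerSeries (Fin 2) ℤ :=
  fun d => if d 0 ≤ d 1 then (JP (d 0) (d 1) : ℤ) else 0

def Good (n : ℕ) (c : ℕ → Bool) : Prop :=
  (∀ i, c i = true → 1 ≤ i ∧ i ≤ n) ∧ c 1 = true ∧ c n = true ∧
  (∀ i, 1 ≤ i → i < n → c i = false → c (i+1) = true) ∧
  (∀ i, 1 ≤ i → i + 2 ≤ n → c i = true → c (i+1) = true → c (i+2) = false)

lemma good_iff (n : ℕ) (hn : 1 ≤ n) (c : ℕ → Bool) :
    (InRange n c ∧ IsMaximal n c ∧ ResistPred n c) ↔ Good n c := by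
  constructor
  · rintro ⟨h1, ⟨h2, -⟩, h4⟩
    have key : ∀ j, 1 ≤ j → j ≤ n → c j = false →
        j ≠ 1 ∧ j ≠ n ∧ c (j-1) = true ∧ c (j+1) = true := by
      intro j hj hjn hc
      have h := h4 j hj hjn hc
      simp only [Sun, occupy, not_or] at h
      rw [if_neg (by omega), if_neg (by omega)] at h
      simpa using h
    refine ⟨h1, ?_, ?_, ?_, ?_⟩
    · by_contra h
      exact (key 1 le_rfl hn (by simpa using h)).1 rfl
    · by_contra h
      exact (key n hn le_rfl (by simpa using h)).2.1 rfl
    · intro i hi hin hc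
      exact (key i hi hin.le hc).2.2.2
    · intro i hi hin ha hb
      have h := h2 (i+1) hb
      simp only [Sun, Nat.add_sub_cancel, ha] at h
      rcases h with h | h | h | h
      · omega
      · omega
      · simp at h
      · exact h
  · rintro ⟨h1, ha, hb, h3, h4⟩
    have hr : ResistPred n c := by
      intro j hj hjn hc h
      have j1 : j ≠ 1 := by rintro rfl; simp_all
      have jn : j ≠ n := by rintro rfl; simp_all
      simp only [Sun, occupy] at h
      rw [if_neg (by omega), if_neg (by omega)] at h
      have hs := h3 j hj (by omega) hc
      have hp : c (j-1) = true := by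
        by_contra hp
        have := h3 (j-1) (by omega) (by omega) (by simpa using hp)
        rw [Nat.sub_add_cancel hj] at this
        simp_all
      simp_all
    refine ⟨h1, ⟨?_, ?_⟩, hr⟩
    · intro i hi
      obtain ⟨hi1, hin⟩ := h1 i hi
      by_cases e1 : i = 1
      · exact Or.inl e1
      by_cases en : i = n
      · exact Or.inr (Or.inl en)
      by_cases hp : c (i-1) = false
      · exact Or.inr (Or.inr (Or.inl hp))
      refine Or.inr (Or.inr (Or.inr ?_))
      obtain ⟨m, rfl⟩ : ∃ m, i = m + 1 := ⟨i-1, by omega⟩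
      exact h4 m (by omega) (by omega) (by simpa using hp) hi
    · intro j hj hjn hc hp
      exact hr j hj hjn hc (hp j (by simp [occupy]))

lemma occ_zero (c : ℕ → Bool) : occ 0 c = 0 := by simp [occ]

lemma occ_sum (n : ℕ) (c : ℕ → Bool) : occ n c = ∑ i ∈ Finset.range n, (c (i+1)).toNat := by
  induction n with
  | zero => simp [occ]
  | succ n ih =>
    rw [Finset.sum_range_succ, ← ih]
    unfold occ
    rw [← Finset.insert_Icc_right_eq_Icc_add_one (by omega), Finset.filter_insert]
    cases h : c (n+1) <;> simp

def ext2 (w : ℕ → Bool) : ℕ → Bool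
  | 0 => false
  | 1 => true
  | 2 => false
  | (i+3) => w (i+1)

def ext3 (w : ℕ → Bool) : ℕ → Bool
  | 0 => false
  | 1 => true
  | 2 => true
  | 3 => false
  | (i+4) => w (i+1)

def sh (m : ℕ) (c : ℕ → Bool) : ℕ → Bool
  | 0 => false
  | (i+1) => c (i+1+m)

lemma occ_ext2 (n : ℕ) (w : ℕ → Bool) : occ (n+2) (ext2 w) = occ n w + 1 := by
  simp [occ_sum, Finset.sum_range_succ', ext2]

lemma occ_ext3 (n : ℕ) (w : ℕ → Bool) : occ (n+3) (ext3 w) = occ n w + 2 := by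
  simp [occ_sum, Finset.sum_range_succ', ext3]

lemma good_ext2 (n : ℕ) (w : ℕ → Bool) (h : Good (n+1) w) : Good (n+3) (ext2 w) := by
  obtain ⟨h1, ha, hb, h3, h4⟩ := h
  refine ⟨?_, rfl, hb, ?_, ?_⟩
  · rintro (_|_|_|i) hi
    · simp [ext2] at hi
    · omega
    · omega
    · have := h1 (i+1) hi
      omega
  · rintro (_|_|_|i) h0 hi hc
    · omega
    · simp [ext2] at hc
    · exact ha
    · exact h3 (i+1) (by omega) (by omega) hc
  · rintro (_|_|_|i) h0 hi hc hd
    · omega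
    · simp [ext2] at hd
    · simp [ext2] at hc
    · exact h4 (i+1) (by omega) (by omega) hc hd

lemma good_ext3 (n : ℕ) (w : ℕ → Bool) (h : Good (n+1) w) : Good (n+4) (ext3 w) := by
  obtain ⟨h1, ha, hb, h3, h4⟩ := h
  refine ⟨?_, rfl, hb, ?_, ?_⟩
  · rintro (_|_|_|_|i) hi
    · simp [ext3] at hi
    · omega
    · omega
    · omega
    · have := h1 (i+1) hi
      omega
  · rintro (_|_|_|_|i) h0 hi hc
    · omega
    · simp [ext3] at hc
    · simp [ext3] at hc
    · exact ha
    · exact h3 (i+1) (by omega) (by omega) hc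
  · rintro (_|_|_|_|i) h0 hi hc hd
    · omega
    · rfl
    · simp [ext3] at hd
    · simp [ext3] at hc
    · exact h4 (i+1) (by omega) (by omega) hc hd

lemma good_sh (m n : ℕ) (c : ℕ → Bool) (h : Good (n+1+m) c) (hm : c (1+m) = true) :
    Good (n+1) (sh m c) := by
  obtain ⟨h1, ha, hb, h3, h4⟩ := h
  refine ⟨?_, hm, hb, ?_, ?_⟩
  · rintro (_|i) hi
    · simp [sh] at hi
    · have := h1 _ hi
      omega
  · rintro (_|i) h0 hi hc
    · omega
    · have := h3 (i+1+m) (by omega) (by omega) hc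
      rw [show i+1+m+1 = i+1+1+m by ring] at this
      exact this
  · rintro (_|i) h0 hi hc hd
    · omega
    · have := h4 (i+1+m) (by omega) (by omega) hc
        (by rw [show i+1+m+1 = i+1+1+m by ring]; exact hd)
      rw [show i+1+m+2 = i+1+1+1+m by ring] at this
      exact this

lemma good_zero {n : ℕ} {c : ℕ → Bool} (h : Good n c) : c 0 = false := by
  by_contra h0
  have := h.1 0 (by simpa using h0)
  omega

def S (k n : ℕ) : Set (ℕ → Bool) := {c | Good n c ∧ occ n c = k}

lemma JP_eq (k n : ℕ) (hn : 1 ≤ n) : JP k n = (S k n).ncard := by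
  rw [← Nat.card_coe_set_eq]
  unfold JP
  have : ∀ c, (InRange n c ∧ IsMaximal n c ∧ ResistPred n c ∧ occ n c = k) ↔ c ∈ S k n := by
    intro c
    rw [S, Set.mem_setOf_eq, ← good_iff n hn]
    tauto
  exact Nat.card_congr (Equiv.subtypeEquivRight this)

lemma S_finite (k n : ℕ) : (S k n).Finite := by
  refine Set.Finite.of_finite_image (f := fun c => (Finset.Icc 1 n).filter (fun i => c i = true))
    (Set.Finite.subset (Finset.finite_toSet (Finset.Icc 1 n).powerset) ?_) ?_
  · rintro _ ⟨c, -, rfl⟩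
    exact Finset.mem_coe.2 (Finset.mem_powerset.2 (Finset.filter_subset _ _))
  · intro c hc d hd h
    funext i
    have hi := congrArg (fun s => i ∈ s) h
    simp only [Finset.mem_filter, Finset.mem_Icc, eq_iff_iff] at hi
    have h1 := hc.1.1 i
    have h2 := hd.1.1 i
    cases h3 : c i <;> cases h4 : d i <;> simp_all

lemma ext2_inj {a b : ℕ → Bool} (h0 : a 0 = b 0) (h : ext2 a = ext2 b) : a = b := by
  funext i
  rcases i with _ | i
  · exact h0
  · exact congrFun h (i+3)

lemma ext3_inj {a b : ℕ → Bool} (h0 : a 0 = b 0) (h : ext3 a = ext3 b) : a = b := by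
  funext i
  rcases i with _ | i
  · exact h0
  · exact congrFun h (i+4)

lemma S_rec (k n : ℕ) : S k (n+4) =
    ext2 '' {w | Good (n+2) w ∧ occ (n+2) w + 1 = k} ∪
    ext3 '' {w | Good (n+1) w ∧ occ (n+1) w + 2 = k} := by
  ext c
  constructor
  · rintro ⟨hg, ho⟩
    have hz := good_zero hg
    have ha := hg.2.1
    cases h2 : c 2
    · left
      have e : ext2 (sh 2 c) = c := by
        funext i
        rcases i with _|_|_|i
        · exact hz.symm
        · exact ha.symm
        · exact h2.symm
        · rfl
      refine ⟨sh 2 c, ⟨good_sh 2 (n+1) c hg (hg.2.2.2.1 2 (by omega) (by omega) h2), ?_⟩, e⟩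
      rw [← occ_ext2, e]; exact ho
    · right
      have h3 : c 3 = false := hg.2.2.2.2 1 (by omega) (by omega) ha h2
      have e : ext3 (sh 3 c) = c := by
        funext i
        rcases i with _|_|_|_|i
        · exact hz.symm
        · exact ha.symm
        · exact h2.symm
        · exact h3.symm
        · rfl
      refine ⟨sh 3 c, ⟨good_sh 3 n c hg (hg.2.2.2.1 3 (by omega) (by omega) h3), ?_⟩, e⟩
      rw [← occ_ext3, e]; exact ho
  · rintro (⟨w, ⟨hg, ho⟩, rfl⟩ | ⟨w, ⟨hg, ho⟩, rfl⟩)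
    · exact ⟨good_ext2 _ _ hg, by rw [← ho, ← occ_ext2]⟩
    · exact ⟨good_ext3 _ _ hg, by rw [← ho, ← occ_ext3]⟩

lemma T_eq (k n m : ℕ) : {w | Good n w ∧ occ n w + m = k} =
    if m ≤ k then S (k-m) n else ∅ := by
  split_ifs with h
  · ext w
    simp only [S, Set.mem_setOf_eq]
    have : occ n w + m = k ↔ occ n w = k - m := by omega
    rw [this]
  · ext w
    simp only [Set.mem_setOf_eq, Set.mem_empty_iff_false, iff_false]
    omega

lemma JP_rec (k n : ℕ) : JP k (n+4) =
    (if 1 ≤ k then JP (k-1) (n+2) else 0) + (if 2 ≤ k then JP (k-2) (n+1) else 0) := by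
  rw [JP_eq _ _ (by omega), JP_eq _ _ (by omega), JP_eq _ _ (by omega), S_rec]
  have f1 : {w | Good (n+2) w ∧ occ (n+2) w + 1 = k}.Finite := by
    rw [T_eq]; split_ifs
    · exact S_finite _ _
    · simp
  have f2 : {w | Good (n+1) w ∧ occ (n+1) w + 2 = k}.Finite := by
    rw [T_eq]; split_ifs
    · exact S_finite _ _
    · simp
  rw [Set.ncard_union_eq _ (f1.image _) (f2.image _), Set.ncard_image_of_injOn,
    Set.ncard_image_of_injOn, T_eq, T_eq]
  · congr 1 <;> split_ifs <;> simp
  · intro a ha b hb h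
    exact ext3_inj (by rw [good_zero ha.1, good_zero hb.1]) h
  · intro a ha b hb h
    exact ext2_inj (by rw [good_zero ha.1, good_zero hb.1]) h
  · rw [Set.disjoint_left]
    rintro _ ⟨a, -, rfl⟩ ⟨b, -, h⟩
    have := congrFun h 2
    simp [ext2, ext3] at this

lemma JP_zero (k : ℕ) : JP k 0 = if k = 0 then 1 else 0 := by
  unfold JP
  split_ifs with h
  · rw [Nat.card_eq_one_iff_unique]
    refine ⟨⟨fun a b => Subtype.ext ?_⟩, ⟨⟨fun _ => false, ?_⟩⟩⟩
    · have : ∀ c : ℕ → Bool, InRange 0 c → c = fun _ => false := by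
        intro c hc
        funext i
        by_contra hi
        have := hc i (by simpa using hi)
        omega
      rw [this _ a.2.1, this _ b.2.1]
    · refine ⟨fun i hi => by simp at hi, ⟨fun i hi => by simp at hi, ?_⟩, ?_, ?_⟩
      · intro j; omega
      · intro j; omega
      · simp [occ_zero, h]
  · have : IsEmpty {c : ℕ → Bool // InRange 0 c ∧ IsMaximal 0 c ∧ ResistPred 0 c ∧ occ 0 c = k} :=
      ⟨fun c => h (by rw [← c.2.2.2.2, occ_zero])⟩
    exact Nat.card_of_isEmpty

lemma JP_base (k n m : ℕ) (hn : 1 ≤ n) (c0 : ℕ → Bool) (h : ∀ c, Good n c ↔ c = c0)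
    (hm : occ n c0 = m) : JP k n = if k = m then 1 else 0 := by
  rw [JP_eq k n hn]
  split_ifs with hk
  · rw [Set.ncard_eq_one]
    refine ⟨c0, ?_⟩
    ext c
    simp only [S, Set.mem_setOf_eq, h, Set.mem_singleton_iff]
    constructor
    · exact fun h => h.1
    · rintro rfl; exact ⟨rfl, by omega⟩
  · have : S k n = ∅ := by
      ext c
      simp only [S, Set.mem_setOf_eq, h, Set.mem_empty_iff_false, iff_false]
      rintro ⟨rfl, h⟩; omega
    simp [this]

lemma JP_one (k : ℕ) : JP k 1 = if k = 1 then 1 else 0 := by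
  refine JP_base k 1 1 le_rfl (fun i => decide (i = 1)) (fun c => ⟨fun h => ?_, ?_⟩) (by decide)
  · obtain ⟨h1, h2, h3, h4, h5⟩ := h
    funext i
    have := h1 i
    by_cases e : i = 1
    · subst e; simp [h2]
    · cases hc : c i
      · simp [e]
      · have := h1 i hc; omega
  · rintro rfl
    refine ⟨?_, by simp, by simp, ?_, ?_⟩
    · intro i hi; simp at hi; omega
    · intro i; omega
    · intro i; omega

lemma JP_two (k : ℕ) : JP k 2 = if k = 2 then 1 else 0 := by
  refine JP_base k 2 2 (by omega) (fun i => decide (i = 1 ∨ i = 2)) (fun c => ⟨fun h => ?_, ?_⟩)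
    (by decide)
  · obtain ⟨h1, h2, h3, h4, h5⟩ := h
    funext i
    by_cases e : i = 1
    · subst e; simp [h2]
    by_cases e : i = 2
    · subst e; simp [h3]
    · cases hc : c i
      · simp [*]
      · have := h1 i hc; omega
  · rintro rfl
    refine ⟨?_, by simp, by simp, ?_, ?_⟩
    · intro i hi; simp at hi; omega
    · intro i h1 h2; simp; omega
    · intro i; omega

lemma JP_three (k : ℕ) : JP k 3 = if k = 2 then 1 else 0 := by
  refine JP_base k 3 2 (by omega) (fun i => decide (i = 1 ∨ i = 3)) (fun c => ⟨fun h => ?_, ?_⟩)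
    (by decide)
  · obtain ⟨h1, h2, h3, h4, h5⟩ := h
    funext i
    by_cases e : i = 1
    · subst e; simp [h2]
    by_cases e : i = 3
    · subst e; simp [h3]
    · cases hc : c i
      · simp [*]
      · have := h1 i hc
        have : i = 2 := by omega
        subst this
        have := h5 1 le_rfl le_rfl h2 hc
        simp_all
  · rintro rfl
    refine ⟨?_, by simp, by simp, ?_, ?_⟩
    · intro i hi; simp at hi; omega
    · intro i h1 h2; simp; omega
    · intro i h1 h2; simp; omega

lemma JP_main (k n : ℕ) : (JP k n : ℤ) =
    (if 1 ≤ k ∧ 2 ≤ n then (JP (k-1) (n-2) : ℤ) else 0) +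
    (if 2 ≤ k ∧ 3 ≤ n then (JP (k-2) (n-3) : ℤ) else 0) +
    ((if k = 0 ∧ n = 0 then 1 else 0) + (if k = 1 ∧ n = 1 then 1 else 0)
      - (if k = 1 ∧ n = 2 then 1 else 0) + (if k = 2 ∧ n = 2 then 1 else 0)
      - (if k = 2 ∧ n = 3 then 1 else 0)) := by
  rcases n with _|_|_|_|n
  · simp [JP_zero]
  · simp [JP_one]
  · simp [JP_two, JP_zero]
    split_ifs <;> first | omega | simp
  · simp [JP_three, JP_one, JP_zero]
    split_ifs <;> first | omega | simp
  · rw [JP_rec]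
    push_cast
    simp

lemma occ_le (n : ℕ) (c : ℕ → Bool) : occ n c ≤ n :=
  (Finset.card_filter_le _ _).trans (by simp)

lemma FP_apply (d : Fin 2 →₀ ℕ) : MvPowerSeries.coeff d FP = (JP (d 0) (d 1) : ℤ) := by
  change FP d = _
  unfold FP
  split_ifs with h
  · rfl
  · have : IsEmpty {c : ℕ → Bool // InRange (d 1) c ∧ IsMaximal (d 1) c ∧ ResistPred (d 1) c ∧
        occ (d 1) c = d 0} :=
      ⟨fun c => h (by rw [← c.2.2.2.2]; exact occ_le _ _)⟩
    unfold JP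
    rw [Nat.card_of_isEmpty]; rfl

noncomputable def ee (a b : ℕ) : Fin 2 →₀ ℕ := Finsupp.single 0 a + Finsupp.single 1 b

lemma ee_zero (a b : ℕ) : ee a b 0 = a := by simp [ee]
lemma ee_one (a b : ℕ) : ee a b 1 = b := by simp [ee]

lemma ee_le (a b : ℕ) (d : Fin 2 →₀ ℕ) : ee a b ≤ d ↔ a ≤ d 0 ∧ b ≤ d 1 := by
  rw [Finsupp.le_def, Fin.forall_fin_two, ee_zero, ee_one]

lemma eq_ee (a b : ℕ) (d : Fin 2 →₀ ℕ) : d = ee a b ↔ d 0 = a ∧ d 1 = b := by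
  rw [Finsupp.ext_iff, Fin.forall_fin_two, ee_zero, ee_one]

lemma XY_eq (a b : ℕ) : Xx ^ a * Yy ^ b = MvPowerSeries.monomial (ee a b) (1 : ℤ) := by
  rw [Xx, Yy, MvPowerSeries.X_pow_eq, MvPowerSeries.X_pow_eq, MvPowerSeries.monomial_mul_monomial,
    one_mul, ee]

/-- `(1 - x y² - x² y³) F^P(x,y) = 1 + x y - x y² + x² y² - x² y³`. -/
theorem stmt1 :
    (1 - Xx * Yy ^ 2 - Xx ^ 2 * Yy ^ 3) * FP =
      1 + Xx * Yy - Xx * Yy ^ 2 + Xx ^ 2 * Yy ^ 2 - Xx ^ 2 * Yy ^ 3 := by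
  classical
  have e0 := XY_eq 0 0
  have e1 := XY_eq 1 1
  have e2 := XY_eq 1 2
  have e3 := XY_eq 2 2
  have e4 := XY_eq 2 3
  simp only [pow_zero, pow_one, mul_one] at e0 e1 e2
  rw [e1, e2, e3, e4, sub_mul, sub_mul, one_mul, e0]
  ext d
  simp only [map_sub, map_add, MvPowerSeries.coeff_monomial_mul, MvPowerSeries.coeff_monomial,
    FP_apply, ee_le, eq_ee, one_mul, Finsupp.tsub_apply, ee_zero, ee_one]
  rw [JP_main (d 0) (d 1)]
  ring
end

section
/- For k ≥ 1 let G_k denote the total number of maximal configurations (of any length n ≥ 1) with exactly k occupied lots that are resistant to predators; this number is finite since any such configuration with k occupied lots has length at most 2k−1. Then G_1 = 1, G_2 = 2, and G_k = G_{k−1} + G_{k−2} for all k ≥ 3 (i.e., the sequence (G_k) satisfies the Fibonacci recurrence). -/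
open Filter

/-- `Gk k`: the total number of maximal configurations (of any length `n ≥ 1`)
with exactly `k` occupied lots that are resistant to predators. -/
noncomputable def Gk (k : ℕ) : ℕ :=
  Nat.card {p : ℕ × (ℕ → Bool) //
    1 ≤ p.1 ∧ InRange p.1 p.2 ∧ IsMaximal p.1 p.2 ∧ ResistPred p.1 p.2 ∧
      occ p.1 p.2 = k}

def VV (n : ℕ) (c : ℕ → Bool) : Prop :=
  1 ≤ n ∧ InRange n c ∧ c 1 = true ∧ c n = true ∧
  (∀ i, 1 ≤ i → i < n → c i = true ∨ c (i+1) = true) ∧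
  (∀ i, c i = true → c (i+1) = true → c (i+2) = false)

lemma VV_iff (n : ℕ) (c : ℕ → Bool) :
    (1 ≤ n ∧ InRange n c ∧ IsMaximal n c ∧ ResistPred n c) ↔ VV n c := by
  have key : ∀ j, (Sun n (occupy c j) j ↔ (j = 1 ∨ j = n ∨ (1 ≤ j ∧ c (j-1) = false) ∨ c (j+1) = false)) := by
    intro j
    unfold Sun occupy
    rcases j with _ | j
    · simp
    · simp
  constructor
  · rintro ⟨h1, hr, ⟨hp, -⟩, hres⟩
    have hr' : ∀ j, 1 ≤ j → j ≤ n → c j = false → ¬ (j = 1 ∨ j = n ∨ (1 ≤ j ∧ c (j-1) = false) ∨ c (j+1) = false) := by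
      intro j a b d
      rw [← key]; exact hres j a b d
    refine ⟨h1, hr, ?_, ?_, ?_, ?_⟩
    · by_contra h
      exact hr' 1 le_rfl h1 (by simpa using h) (by simp)
    · by_contra h
      exact hr' n h1 le_rfl (by simpa using h) (by simp)
    · intro i a b
      by_contra h
      push Not at h
      have h0 : c i = false := by simpa using h.1
      have h2 : c (i+1) = false := by simpa using h.2
      exact hr' i a b.le h0 (by simp [h2])
    · intro i a b
      by_contra h
      have h : c (i+2) = true := by simpa using h
      have hs := hp (i+1) b
      have := hr i a
      have := hr _ h
      unfold Sun at hs
      have e : i + 1 - 1 = i := by omega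
      rw [e, a, show i+1+1 = i+2 by rfl, h] at hs
      simp at hs
      omega
  · rintro ⟨h1, hr, c1, cn, hz, ho⟩
    have hres : ResistPred n c := by
      intro j a b d
      rw [key]
      rintro (h | h | ⟨-, h⟩ | h)
      · subst h; simp_all
      · subst h; simp_all
      · have hj : j ≠ 1 := by rintro rfl; simp_all
        have := hz (j-1) (by omega) (by omega)
        rw [show j - 1 + 1 = j by omega] at this
        simp_all
      · have hj : j ≠ n := by rintro rfl; simp_all
        have := hz j a (by omega)
        simp_all
    refine ⟨h1, hr, ⟨?_, ?_⟩, hres⟩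
    · intro i hi
      have := hr i hi
      unfold Sun
      by_cases h : c (i-1) = true
      · have := ho (i-1) h (by rw [show i-1+1 = i by omega]; exact hi)
        rw [show i-1+2 = i+1 by omega] at this
        simp [this]
      · simp at h; simp [h]
    · intro j a b d hp
      exact hres j a b d (hp j (by simp [occupy]))

lemma occ_eq (n : ℕ) (c : ℕ → Bool) :
    occ n c = ∑ i ∈ Finset.range n, if c (i+1) = true then 1 else 0 := by
  unfold occ
  rw [Finset.card_filter, Finset.range_eq_Ico,
    Finset.sum_Ico_add' (fun i => if c i = true then 1 else 0) 0 n 1]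
  rfl

def ff1 (p : ℕ × (ℕ → Bool)) : ℕ × (ℕ → Bool) := (p.1 + 2, fun i => i == 1 || p.2 (i-2))
def ff2 (p : ℕ × (ℕ → Bool)) : ℕ × (ℕ → Bool) := (p.1 + 3, fun i => i == 1 || (i == 2 || p.2 (i-3)))
def ee1 : ℕ × (ℕ → Bool) := (1, fun i => i == 1)
def ee2 : ℕ × (ℕ → Bool) := (2, fun i => i == 1 || i == 2)

lemma c0 {n c} (h : VV n c) : c 0 = false := by
  by_contra h'
  have := h.2.1 0 (by simpa using h')
  omega

lemma occ1 {p : ℕ × (ℕ → Bool)} (h : VV p.1 p.2) : occ (ff1 p).1 (ff1 p).2 = occ p.1 p.2 + 1 := by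
  have := c0 h
  rw [occ_eq, occ_eq]
  simp only [ff1]
  rw [Finset.sum_range_succ', Finset.sum_range_succ']
  simp [this, -Finset.sum_boole]

lemma occ2 {p : ℕ × (ℕ → Bool)} (h : VV p.1 p.2) : occ (ff2 p).1 (ff2 p).2 = occ p.1 p.2 + 2 := by
  have := c0 h
  rw [occ_eq, occ_eq]
  simp only [ff2]
  rw [Finset.sum_range_succ', Finset.sum_range_succ', Finset.sum_range_succ']
  simp [this, -Finset.sum_boole]

lemma occe1 : occ ee1.1 ee1.2 = 1 := by decide
lemma occe2 : occ ee2.1 ee2.2 = 2 := by decide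

lemma VVe1 : VV ee1.1 ee1.2 := by
  refine ⟨by decide, ?_, by decide, by decide, ?_, ?_⟩
  · intro i; simp [ee1]; omega
  · intro i; simp [ee1]; omega
  · intro i; simp [ee1]
lemma VVe2 : VV ee2.1 ee2.2 := by
  refine ⟨by decide, ?_, by decide, by decide, ?_, ?_⟩
  · intro i; simp [ee2]; omega
  · intro i; simp [ee2]; omega
  · intro i; simp [ee2]; omega

lemma VV1 {p : ℕ × (ℕ → Bool)} (h : VV p.1 p.2) : VV (ff1 p).1 (ff1 p).2 := by
  have h0 := c0 h
  obtain ⟨n, c⟩ := p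
  obtain ⟨h1, hr, c1, cn, hz, ho⟩ := h
  refine ⟨by simp [ff1], ?_, by simp [ff1], by simp [ff1]; simpa using cn, ?_, ?_⟩
  · intro i hi
    simp only [ff1, Bool.or_eq_true, beq_iff_eq] at hi ⊢
    rcases hi with hi | hi
    · omega
    · have := hr _ hi
      simp only at this
      omega
  · intro i a b
    simp only [ff1] at b ⊢
    rcases i with _ | _ | _ | i
    · omega
    · simp
    · right; simpa using c1
    · simpa using hz (i+1) (by omega) (by simp only; omega)
  · intro i
    rcases i with _ | _ | _ | i
    · simp_all [ff1]
    · simp_all [ff1]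
    · simp_all [ff1]
    · simpa [ff1] using ho (i+1)

lemma VV2 {p : ℕ × (ℕ → Bool)} (h : VV p.1 p.2) : VV (ff2 p).1 (ff2 p).2 := by
  have h0 := c0 h
  obtain ⟨n, c⟩ := p
  obtain ⟨h1, hr, c1, cn, hz, ho⟩ := h
  refine ⟨by simp [ff2], ?_, by simp [ff2], by simp [ff2]; simpa using cn, ?_, ?_⟩
  · intro i hi
    simp only [ff2, Bool.or_eq_true, beq_iff_eq] at hi ⊢
    rcases hi with hi | hi | hi
    · omega
    · omega
    · have := hr _ hi
      simp only at this
      omega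
  · intro i a b
    simp only [ff2] at b ⊢
    rcases i with _ | _ | _ | _ | i
    · omega
    · simp
    · simp
    · right; simpa using c1
    · simpa using hz (i+1) (by omega) (by simp only; omega)
  · intro i
    rcases i with _ | _ | _ | _ | i
    · simp_all [ff2]
    · simp_all [ff2]
    · simp_all [ff2]
    · simp_all [ff2]
    · simpa [ff2] using ho (i+1)

lemma VV_cases {n : ℕ} {c : ℕ → Bool} (h : VV n c) :
    (n, c) = ee1 ∨ (n, c) = ee2 ∨ (∃ q : ℕ × (ℕ → Bool), VV q.1 q.2 ∧ (n, c) = ff1 q) ∨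
      (∃ q : ℕ × (ℕ → Bool), VV q.1 q.2 ∧ (n, c) = ff2 q) := by
  have h0 := c0 h
  obtain ⟨h1, hr, c1, cn, hz, ho⟩ := h
  have hgt : ∀ i, n < i → c i = false := by
    intro i hi
    by_contra h
    have := hr i (by simpa using h)
    omega
  by_cases n1 : n = 1
  · left
    subst n1
    refine Prod.ext rfl (funext fun i => ?_)
    rcases i with _ | _ | i
    · simpa [ee1] using h0
    · simpa [ee1] using c1
    · simpa [ee1] using hgt (i+2) (by omega)
  by_cases c2 : c 2 = true
  · have c3 := ho 1 c1 c2
    by_cases n2 : n = 2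
    · right; left
      subst n2
      refine Prod.ext rfl (funext fun i => ?_)
      rcases i with _ | _ | _ | i
      · simpa [ee2] using h0
      · simpa [ee2] using c1
      · simpa [ee2] using c2
      · simpa [ee2] using hgt (i+3) (by omega)
    · right; right; right
      have n3 : n ≠ 3 := by rintro rfl; simp_all
      obtain ⟨m, rfl⟩ : ∃ m, n = m + 1 + 3 := ⟨n - 4, by omega⟩
      refine ⟨(m+1, fun i => c (i+3)), ⟨by simp, ?_, ?_, cn, ?_, ?_⟩, ?_⟩
      · intro i hi
        have := hr _ hi
        have : i ≠ 0 := by rintro rfl; simp_all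
        simp only; omega
      · have := hz 3 (by omega) (by omega)
        simp_all
      · intro i a b
        simp only at b
        have := hz (i+3) (by omega) (by omega)
        rwa [show i + 3 + 1 = i + 1 + 3 by omega] at this
      · intro i
        have := ho (i+3)
        rwa [show i + 3 + 1 = i + 1 + 3 by omega, show i + 3 + 2 = i + 2 + 3 by omega] at this
      · refine Prod.ext rfl (funext fun i => ?_)
        rcases i with _ | _ | _ | i <;> simp_all [ff2]
  · have c2 : c 2 = false := by simpa using c2
    right; right; left
    have n2 : n ≠ 2 := by rintro rfl; simp_all
    obtain ⟨m, rfl⟩ : ∃ m, n = m + 1 + 2 := ⟨n - 3, by omega⟩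
    refine ⟨(m+1, fun i => c (i+2)), ⟨by simp, ?_, ?_, cn, ?_, ?_⟩, ?_⟩
    · intro i hi
      have := hr _ hi
      have : i ≠ 0 := by rintro rfl; simp_all
      simp only; omega
    · have := hz 2 (by omega) (by omega)
      simp_all
    · intro i a b
      simp only at b
      have := hz (i+2) (by omega) (by omega)
      rwa [show i + 2 + 1 = i + 1 + 2 by omega] at this
    · intro i
      have := ho (i+2)
      rwa [show i + 2 + 1 = i + 1 + 2 by omega] at this
    · refine Prod.ext rfl (funext fun i => ?_)
      rcases i with _ | _ | i <;> simp_all [ff1]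

def SS (k : ℕ) : Set (ℕ × (ℕ → Bool)) := {p | VV p.1 p.2 ∧ occ p.1 p.2 = k}

lemma Gk_eq (k : ℕ) : Gk k = (SS k).ncard := by
  unfold Gk
  rw [← Nat.card_coe_set_eq]
  refine Nat.card_congr (Equiv.subtypeEquivRight fun p => ?_)
  simp only [SS, Set.mem_ofPred_eq, ← VV_iff]
  tauto

lemma occ_pos {n c} (h : VV n c) : 1 ≤ occ n c := by
  unfold occ
  exact Finset.card_pos.2 ⟨1, by simp [h.1, h.2.2.1]⟩

lemma bound : ∀ n c, VV n c → n ≤ 2 * occ n c - 1 := by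
  intro n
  induction n using Nat.strong_induction_on with
  | _ n ih =>
    intro c h
    rcases VV_cases h with e | e | ⟨q, hq, e⟩ | ⟨q, hq, e⟩
    · have := occe1; rw [← e] at this; simp [ee1] at e this; omega
    · have := occe2; rw [← e] at this; simp [ee2] at e this; omega
    · have := occ1 hq
      have hp := occ_pos hq
      have e1 : n = q.1 + 2 := congrArg Prod.fst e
      have := ih q.1 (by omega) q.2 hq
      rw [← e] at *
      simp only at *
      omega
    · have := occ2 hq
      have hp := occ_pos hq
      have e1 : n = q.1 + 3 := congrArg Prod.fst e
      have := ih q.1 (by omega) q.2 hq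
      rw [← e] at *
      simp only at *
      omega

lemma SS0 : SS 0 = ∅ := by
  ext p
  simp only [SS, Set.mem_ofPred_eq, Set.mem_empty_iff_false, iff_false, not_and]
  intro h
  have := occ_pos h
  omega

lemma SS1 : SS 1 = {ee1} := by
  ext p
  simp only [SS, Set.mem_ofPred_eq, Set.mem_singleton_iff]
  constructor
  · rintro ⟨h, ho⟩
    rcases VV_cases h with e | e | ⟨q, hq, e⟩ | ⟨q, hq, e⟩
    · exact e
    · have := occe2; rw [← e] at this; simp only at this; omega
    · have := occ1 hq; have := occ_pos hq; rw [← e] at *; simp only at *; omega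
    · have := occ2 hq; have := occ_pos hq; rw [← e] at *; simp only at *; omega
  · rintro rfl; exact ⟨VVe1, occe1⟩

lemma SS2 : SS 2 = {ee2, ff1 ee1} := by
  ext p
  simp only [SS, Set.mem_ofPred_eq, Set.mem_insert_iff, Set.mem_singleton_iff]
  constructor
  · rintro ⟨h, ho⟩
    rcases VV_cases h with e | e | ⟨q, hq, e⟩ | ⟨q, hq, e⟩
    · have := occe1; rw [← e] at this; simp only at this; omega
    · exact Or.inl e
    · have := occ1 hq
      rw [← e] at this; simp only at this
      have hq1 : q ∈ SS 1 := ⟨hq, by omega⟩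
      rw [SS1] at hq1
      right; rw [← show q = ee1 from hq1]; exact e
    · have := occ2 hq; have := occ_pos hq; rw [← e] at *; simp only at *; omega
  · rintro (rfl | rfl)
    · exact ⟨VVe2, occe2⟩
    · exact ⟨VV1 VVe1, by rw [occ1 VVe1, occe1]⟩

lemma SSrec (k : ℕ) : SS (k+3) = ff1 '' SS (k+2) ∪ ff2 '' SS (k+1) := by
  ext p
  constructor
  · rintro ⟨h, ho⟩
    rcases VV_cases h with e | e | ⟨q, hq, e⟩ | ⟨q, hq, e⟩
    · have := occe1; rw [← e] at this; simp only at this; omega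
    · have := occe2; rw [← e] at this; simp only at this; omega
    · have := occ1 hq
      rw [← e] at this; simp only at this
      exact Or.inl ⟨q, ⟨hq, by omega⟩, e.symm⟩
    · have := occ2 hq
      rw [← e] at this; simp only at this
      exact Or.inr ⟨q, ⟨hq, by omega⟩, e.symm⟩
  · rintro (⟨q, ⟨hq, ho⟩, rfl⟩ | ⟨q, ⟨hq, ho⟩, rfl⟩)
    · exact ⟨VV1 hq, by rw [occ1 hq, ho]⟩
    · exact ⟨VV2 hq, by rw [occ2 hq, ho]⟩

lemma inj1 (k : ℕ) : Set.InjOn ff1 (SS k) := by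
  rintro ⟨n, c⟩ h ⟨m, d⟩ h' e
  have e1 := congrArg Prod.fst e
  have e2 := congrArg Prod.snd e
  simp only [ff1] at e1 e2
  refine Prod.ext (by simp only; omega) (funext fun i => ?_)
  simpa using congrFun e2 (i+2)

lemma inj2 (k : ℕ) : Set.InjOn ff2 (SS k) := by
  rintro ⟨n, c⟩ h ⟨m, d⟩ h' e
  have e1 := congrArg Prod.fst e
  have e2 := congrArg Prod.snd e
  simp only [ff2] at e1 e2
  refine Prod.ext (by simp only; omega) (funext fun i => ?_)
  simpa using congrFun e2 (i+3)

lemma disj (k l : ℕ) : Disjoint (ff1 '' SS k) (ff2 '' SS l) := by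
  rw [Set.disjoint_left]
  rintro _ ⟨p, ⟨hp, -⟩, rfl⟩ ⟨q, hq, e⟩
  have := congrFun (congrArg Prod.snd e) 2
  simp [ff1, ff2, c0 hp] at this

lemma SSfin : ∀ k, (SS k).Finite
  | 0 => by rw [SS0]; exact Set.finite_empty
  | 1 => by rw [SS1]; exact Set.finite_singleton _
  | 2 => by rw [SS2]; exact Set.toFinite _
  | k+3 => by rw [SSrec]; exact ((SSfin (k+2)).image _).union ((SSfin (k+1)).image _)

/-- any such configuration with `k ≥ 1` houses has length at most
`2k - 1`, and `(G_k)` satisfies the Fibonacci recurrence. -/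
theorem stmt4 :
    (∀ k, 1 ≤ k → ∀ n c, InRange n c → IsMaximal n c → ResistPred n c →
      occ n c = k → n ≤ 2 * k - 1) ∧
    Gk 1 = 1 ∧ Gk 2 = 2 ∧ ∀ k, 3 ≤ k → Gk k = Gk (k - 1) + Gk (k - 2) := by
  refine ⟨?_, ?_, ?_, ?_⟩
  · rintro k hk n c h1 h2 h3 rfl
    rcases Nat.eq_zero_or_pos n with rfl | hn
    · omega
    · exact bound n c ((VV_iff n c).1 ⟨hn, h1, h2, h3⟩)
  · rw [Gk_eq, SS1, Set.ncard_singleton]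
  · rw [Gk_eq, SS2, Set.ncard_pair]
    intro h
    have := congrArg Prod.fst h
    simp [ee2, ff1, ee1] at this
  · intro k hk
    obtain ⟨k, rfl⟩ : ∃ m, k = m + 3 := ⟨k - 3, by omega⟩
    rw [show k + 3 - 1 = k + 2 by omega, show k + 3 - 2 = k + 1 by omega, Gk_eq, Gk_eq, Gk_eq,
      SSrec, Set.ncard_union_eq (disj _ _) ((SSfin _).image _) ((SSfin _).image _),
      Set.ncard_image_of_injOn (inj1 _), Set.ncard_image_of_injOn (inj2 _)]
end
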